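/- (Optimality at binary powers) Let ℓ ≥ 1 be a natural number, set n = 2^ℓ, and let q be the least natural number with n · (q + 1) ≤ 2^q. Then W q n 0 and ¬ W (q − 1) n 0; that is, q₁(2^ℓ) = q. -/

import Mathlib

/-- `W j a b` : the questioner can force a win within `j` questions from
state `(a, b)` (a = candidates fitting all answers, b = candidates fitting
all but exactly one answer) in Ulam's liar game with one lie. -/
def W : ℕ → ℕ → ℕ → Prop
  | 0, a, b => a + b ≤ 1
  | (j+1), a, b => ∃ a₁ a₂ b₁ b₂ : ℕ, a₁ + a₂ = a ∧ b₁ + b₂ = b ∧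
      W j a₁ (b₁ + a₂) ∧ W j a₂ (b₂ + a₁)

/-- The Berlekamp weight bound: a state that can be won within `j` questions
has weight at most `2 ^ j`. -/
theorem W.weight_le {j a b : ℕ} (h : W j a b) : a * (j + 1) + b ≤ 2 ^ j := by
  induction j generalizing a b with
  | zero => simpa [W] using h
  | succ j ih =>
    obtain ⟨a₁, a₂, b₁, b₂, rfl, rfl, h₁, h₂⟩ := h
    have hw₁ := ih h₁
    have hw₂ := ih h₂
    rw [pow_succ]
    linarith

/-- With no consistent candidate left, plain bisection wins. -/
theorem W_zero_of_le {j b : ℕ} (h : b ≤ 2 ^ j) : W j 0 b := by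
  induction j generalizing b with
  | zero => simpa [W] using h
  | succ j ih =>
    rw [pow_succ] at h
    exact ⟨0, 0, b / 2, b - b / 2, rfl, by omega, ih (by omega), ih (by omega)⟩

/-- With a single consistent candidate, the weight bound is sufficient. -/
theorem W_one_of_le {j b : ℕ} (h : j + 1 + b ≤ 2 ^ j) : W j 1 b := by
  induction j generalizing b with
  | zero => simpa [W, add_comm] using h
  | succ j ih =>
    have hj : j < 2 ^ j := Nat.lt_two_pow_self
    rw [pow_succ] at h
    exact ⟨1, 0, b - min b (2 ^ j - 1), min b (2 ^ j - 1), rfl, by omega,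
      ih (by omega), W_zero_of_le (by omega)⟩

/-- Halving both kinds of candidates `k` times reduces `(2 ^ k, i * 2 ^ k)` to `(1, i + k)`. -/
theorem W_two_pow {r k i : ℕ} (h : W r 1 (i + k)) : W (r + k) (2 ^ k) (i * 2 ^ k) := by
  induction k generalizing i with
  | zero => simpa using h
  | succ k ih =>
    have hw : W (r + k) (2 ^ k) (i * 2 ^ k + 2 ^ k) := by
      rw [← Nat.succ_mul]
      exact ih (by rwa [Nat.succ_add_eq_add_succ])
    exact ⟨2 ^ k, 2 ^ k, i * 2 ^ k, i * 2 ^ k, by ring, by ring, hw, hw⟩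

theorem optimal_at_binary_powers (ℓ n q : ℕ) (hℓ : 1 ≤ ℓ) (hn : n = 2 ^ ℓ)
    (hq : IsLeast {m : ℕ | n * (m + 1) ≤ 2 ^ m} q) :
    W q n 0 ∧ ¬ W (q - 1) n 0 := by
  subst hn
  obtain ⟨hmem, hmin⟩ := hq
  have hmem : 2 ^ ℓ * (q + 1) ≤ 2 ^ q := hmem
  have hle : ℓ ≤ q := (Nat.pow_le_pow_iff_right one_lt_two).1
    ((Nat.le_mul_of_pos_right _ q.succ_pos).trans hmem)
  constructor
  · obtain ⟨r, rfl⟩ := Nat.exists_eq_add_of_le' hle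
    rw [pow_add, mul_comm (2 ^ r)] at hmem
    have hr : r + ℓ + 1 ≤ 2 ^ r := Nat.le_of_mul_le_mul_left hmem (by positivity)
    simpa using W_two_pow (i := 0) (W_one_of_le (j := r) (b := 0 + ℓ) (by omega))
  · intro h
    have hq' : q ≤ q - 1 := hmin h.weight_le
    omega
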